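/- arXiv:1512.06485 — 4 statements merged into one kernel-verified Lean document; each statement's English description precedes it below -/
import Mathlib

section
/- The 4p−4 product states ψ_1,…,ψ_{4p−4} form an orthonormal family in ℂ^m ⊗ ℂ^n: each ψ_k has norm 1, and ⟨ψ_k, ψ_l⟩ = 0 whenever k ≠ l. -/
open scoped ComplexInnerProductSpace Kronecker ComplexOrder

/-- The `i`-th standard basis vector `|i⟩` of `ℂ^m` (zero if `i ≥ m`). -/
noncomputable def ket (m i : ℕ) : EuclideanSpace ℂ (Fin m) :=
  (WithLp.equiv 2 (Fin m → ℂ)).symm fun a => if (a : ℕ) = i then 1 else 0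

/-- The product state `v ⊗ w`, with entries `(v ⊗ w)_{(a,b)} = v_a * w_b`. -/
noncomputable def tp {m n : ℕ} (v : EuclideanSpace ℂ (Fin m)) (w : EuclideanSpace ℂ (Fin n)) :
    EuclideanSpace ℂ (Fin m × Fin n) :=
  (WithLp.equiv 2 (Fin m × Fin n → ℂ)).symm fun ab => v ab.1 * w ab.2

/-- The scalar `1/√2`. -/
noncomputable def invSqrt2 : ℂ := ((Real.sqrt 2)⁻¹ : ℝ)

/-- A matrix on `ℂ^m ⊗ ℂ^n` acting as a linear map. -/
noncomputable def act {m n : ℕ} (M : Matrix (Fin m × Fin n) (Fin m × Fin n) ℂ)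
    (x : EuclideanSpace ℂ (Fin m × Fin n)) : EuclideanSpace ℂ (Fin m × Fin n) :=
  Matrix.toEuclideanLin M x

/-- The index `j(i)`: `j(i) = i + 1` for `i ≤ p - 2`, and `j(p-1) = 1`. -/
def jf (p i : ℕ) : ℕ := if i = p - 1 then 1 else i + 1

/-- The `4p-4` product states `ψ_k` (`1 ≤ k ≤ 4p-4`):
`ψ_i = |i⟩ ⊗ (|0⟩-|i⟩)/√2`, `ψ_{i+p-1} = (|0⟩-|i⟩)/√2 ⊗ |j(i)⟩`,
`ψ_{i+2p-2} = |i⟩ ⊗ (|0⟩+|i⟩)/√2`, `ψ_{i+3p-3} = (|0⟩+|i⟩)/√2 ⊗ |j(i)⟩`, for `1 ≤ i ≤ p-1`. -/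
noncomputable def psi (m n p k : ℕ) : EuclideanSpace ℂ (Fin m × Fin n) :=
  if k ≤ p - 1 then tp (ket m k) (invSqrt2 • (ket n 0 - ket n k))
  else if k ≤ 2 * p - 2 then
    tp (invSqrt2 • (ket m 0 - ket m (k - (p - 1)))) (ket n (jf p (k - (p - 1))))
  else if k ≤ 3 * p - 3 then
    tp (ket m (k - (2 * p - 2))) (invSqrt2 • (ket n 0 + ket n (k - (2 * p - 2))))
  else tp (invSqrt2 • (ket m 0 + ket m (k - (3 * p - 3)))) (ket n (jf p (k - (3 * p - 3))))

theorem inner_tp {m n : ℕ} (v v' : EuclideanSpace ℂ (Fin m)) (w w' : EuclideanSpace ℂ (Fin n)) :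
    ⟪tp v w, tp v' w'⟫ = ⟪v, v'⟫ * ⟪w, w'⟫ := by
  simp only [PiLp.inner_apply, Fintype.sum_prod_type, Finset.sum_mul_sum, tp]
  refine Finset.sum_congr rfl fun a _ => Finset.sum_congr rfl fun b _ => ?_
  simp
  ring

theorem inner_ket {m i : ℕ} (hi : i < m) (j : ℕ) :
    ⟪ket m i, ket m j⟫ = if i = j then 1 else 0 := by
  simp only [PiLp.inner_apply, ket]
  rw [Finset.sum_eq_single (⟨i, hi⟩ : Fin m)]
  · simp
  · intro b _ hb
    have : (b : ℕ) ≠ i := fun h => hb (Fin.ext h)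
    simp [this]
  · simp

theorem invSqrt2_mul_self : invSqrt2 * invSqrt2 = 1 / 2 := by
  rw [invSqrt2, ← Complex.ofReal_mul, ← mul_inv, Real.mul_self_sqrt zero_le_two]
  norm_num

theorem conj_invSqrt2 : starRingEnd ℂ invSqrt2 = invSqrt2 :=
  Complex.conj_ofReal _

/-- The superposition `(|0⟩ + s|i⟩)/√2`. -/
noncomputable def superpos (n : ℕ) (s : ℝ) (i : ℕ) : EuclideanSpace ℂ (Fin n) :=
  invSqrt2 • (ket n 0 + (s : ℂ) • ket n i)

theorem inner_superpos {n i j : ℕ} (s t : ℝ) (hi : i ≠ 0) (hin : i < n) (hj : j ≠ 0) :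
    ⟪superpos n s i, superpos n t j⟫ = if i = j then (1 + s * t : ℂ) / 2 else 1 / 2 := by
  simp only [superpos, inner_smul_left, inner_smul_right, inner_add_left, inner_add_right,
    inner_ket hin, inner_ket (Nat.zero_lt_of_lt hin), conj_invSqrt2, Complex.conj_ofReal,
    hi, hj.symm, if_true, if_false]
  split_ifs
  · linear_combination (1 + s * t : ℂ) * invSqrt2_mul_self
  · linear_combination invSqrt2_mul_self

theorem inner_ket_superpos {n i j : ℕ} (s : ℝ) (hi : i ≠ 0) (hin : i < n) (hij : i ≠ j) :
    ⟪ket n i, superpos n s j⟫ = 0 := by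
  simp [superpos, inner_ket hin, hi, hij]

theorem inner_superpos_ket {n i j : ℕ} (s : ℝ) (hi : i ≠ 0) (hin : i < n) (hij : i ≠ j) :
    ⟪superpos n s j, ket n i⟫ = 0 := by
  rw [← inner_conj_symm, inner_ket_superpos s hi hin hij, map_zero]

/-- The states `|i⟩ ⊗ (|0⟩ + s|i⟩)/√2`. -/
noncomputable def ketSuperpos (m n : ℕ) (s : ℝ) (i : ℕ) : EuclideanSpace ℂ (Fin m × Fin n) :=
  tp (ket m i) (superpos n s i)

/-- The states `(|0⟩ + s|i⟩)/√2 ⊗ |j(i)⟩`. -/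
noncomputable def superposKet (m n p : ℕ) (s : ℝ) (i : ℕ) : EuclideanSpace ℂ (Fin m × Fin n) :=
  tp (superpos m s i) (ket n (jf p i))

theorem jf_ne_zero (p i : ℕ) : jf p i ≠ 0 := by
  unfold jf; split_ifs <;> omega

theorem jf_lt {p i : ℕ} (h3 : 3 ≤ p) (hi : i < p) : jf p i < p := by
  unfold jf; split_ifs <;> omega

theorem jf_ne_self {p : ℕ} (h3 : 3 ≤ p) (i : ℕ) : jf p i ≠ i := by
  unfold jf; split_ifs <;> omega

theorem jf_inj {p i j : ℕ} (hi : i ≠ 0) (hj : j ≠ 0) : jf p i = jf p j ↔ i = j := by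
  unfold jf; split_ifs <;> omega

theorem inner_ketSuperpos {m n i j : ℕ} (s t : ℝ) (hi : i ≠ 0) (him : i < m) (hin : i < n)
    (hj : j ≠ 0) :
    ⟪ketSuperpos m n s i, ketSuperpos m n t j⟫ = if i = j then (1 + s * t : ℂ) / 2 else 0 := by
  rw [ketSuperpos, ketSuperpos, inner_tp, inner_ket him, inner_superpos s t hi hin hj]
  split_ifs <;> simp

theorem inner_superposKet {m n p i j : ℕ} (s t : ℝ) (h3 : 3 ≤ p) (hpm : p ≤ m) (hpn : p ≤ n)
    (hi : i ≠ 0) (hip : i < p) (hj : j ≠ 0) :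
    ⟪superposKet m n p s i, superposKet m n p t j⟫ =
      if i = j then (1 + s * t : ℂ) / 2 else 0 := by
  rw [superposKet, superposKet, inner_tp, inner_ket ((jf_lt h3 hip).trans_le hpn),
    inner_superpos s t hi (hip.trans_le hpm) hj]
  simp only [jf_inj hi hj]
  split_ifs <;> simp

theorem inner_ketSuperpos_superposKet {m n p i j : ℕ} (s t : ℝ) (h3 : 3 ≤ p) (hpn : p ≤ n)
    (hi : i ≠ 0) (him : i < m) (hjp : j < p) :
    ⟪ketSuperpos m n s i, superposKet m n p t j⟫ = 0 := by
  rw [ketSuperpos, superposKet, inner_tp]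
  rcases eq_or_ne i j with rfl | hij
  · rw [inner_superpos_ket s (jf_ne_zero p i) ((jf_lt h3 hjp).trans_le hpn) (jf_ne_self h3 i),
      mul_zero]
  · rw [inner_ket_superpos t hi him hij, zero_mul]

theorem inner_superposKet_ketSuperpos {m n p i j : ℕ} (s t : ℝ) (h3 : 3 ≤ p) (hpn : p ≤ n)
    (hi : i ≠ 0) (him : i < m) (hjp : j < p) :
    ⟪superposKet m n p t j, ketSuperpos m n s i⟫ = 0 := by
  rw [← inner_conj_symm, inner_ketSuperpos_superposKet s t h3 hpn hi him hjp, map_zero]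

theorem psi_cases (m n : ℕ) {p k : ℕ} (hk : 1 ≤ k) (hkp : k ≤ 4 * p - 4) :
    ∃ i, i ≠ 0 ∧ i < p ∧
      ((k = i ∧ psi m n p k = ketSuperpos m n (-1) i) ∨
        (k = i + (p - 1) ∧ psi m n p k = superposKet m n p (-1) i) ∨
        (k = i + (2 * p - 2) ∧ psi m n p k = ketSuperpos m n 1 i) ∨
        (k = i + (3 * p - 3) ∧ psi m n p k = superposKet m n p 1 i)) := by
  unfold psi ketSuperpos superposKet superpos
  split_ifs
  · exact ⟨k, by omega, by omega, .inl ⟨rfl, by simp [sub_eq_add_neg]⟩⟩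
  · exact ⟨k - (p - 1), by omega, by omega, .inr (.inl ⟨by omega, by simp [sub_eq_add_neg]⟩)⟩
  · exact ⟨k - (2 * p - 2), by omega, by omega, .inr (.inr (.inl ⟨by omega, by simp⟩))⟩
  · exact ⟨k - (3 * p - 3), by omega, by omega, .inr (.inr (.inr ⟨by omega, by simp⟩))⟩

theorem inner_psi {m n p k l : ℕ} (h3 : 3 ≤ p) (hpm : p ≤ m) (hpn : p ≤ n)
    (hk : 1 ≤ k) (hkp : k ≤ 4 * p - 4) (hl : 1 ≤ l) (hlp : l ≤ 4 * p - 4) :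
    ⟪psi m n p k, psi m n p l⟫ = if k = l then 1 else 0 := by
  obtain ⟨i, hi, hip, hik⟩ := psi_cases m n hk hkp
  obtain ⟨j, hj, hjp, hjl⟩ := psi_cases m n hl hlp
  have him := hip.trans_le hpm
  have hin := hip.trans_le hpn
  have hjm := hjp.trans_le hpm
  rcases hik with ⟨hki, h⟩ | ⟨hki, h⟩ | ⟨hki, h⟩ | ⟨hki, h⟩ <;>
  rcases hjl with ⟨hlj, h'⟩ | ⟨hlj, h'⟩ | ⟨hlj, h'⟩ | ⟨hlj, h'⟩ <;>
  rw [h, h'] <;>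
  first
  | rw [inner_ketSuperpos _ _ hi him hin hj]
    split_ifs <;> first | omega | norm_num
  | rw [inner_superposKet _ _ h3 hpm hpn hi hip hj]
    split_ifs <;> first | omega | norm_num
  | rw [inner_ketSuperpos_superposKet _ _ h3 hpn hi him hjp, if_neg (by omega)]
  | rw [inner_superposKet_ketSuperpos _ _ h3 hpn hj hjm hip, if_neg (by omega)]

theorem four_p_minus_four_orthonormal (p m n : ℕ) (h3 : 3 ≤ p) (hpm : p ≤ m) (hmn : m ≤ n) :
    (∀ k, 1 ≤ k → k ≤ 4 * p - 4 → ‖psi m n p k‖ = 1) ∧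
    (∀ k l, 1 ≤ k → k ≤ 4 * p - 4 → 1 ≤ l → l ≤ 4 * p - 4 → k ≠ l →
      ⟪psi m n p k, psi m n p l⟫ = 0) := by
  have hpn := hpm.trans hmn
  refine ⟨fun k hk hkp => ?_, fun k l hk hkp hl hlp hkl => ?_⟩
  · rw [norm_eq_sqrt_re_inner (𝕜 := ℂ), inner_psi h3 hpm hpn hk hkp hk hkp]
    simp
  · rw [inner_psi h3 hpm hpn hk hkp hl hlp, if_neg hkl]
end

section
/- If ⟨ψ_k, (B ⊗ I_n) ψ_l⟩ = 0 for all k, l with 1 ≤ k, l ≤ 4p−4 and k ≠ l, then the matrix entries satisfy B_{0j} = B_{j0} = 0 for all 1 ≤ j ≤ p−1. -/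
open scoped ComplexInnerProductSpace Kronecker ComplexOrder

theorem inner_tp_act_kronecker_one {m n : ℕ} (B : Matrix (Fin m) (Fin m) ℂ)
    (v v' : EuclideanSpace ℂ (Fin m)) (w w' : EuclideanSpace ℂ (Fin n)) :
    ⟪tp v w, act (B ⊗ₖ (1 : Matrix (Fin n) (Fin n) ℂ)) (tp v' w')⟫
      = ⟪v, Matrix.toEuclideanLin B v'⟫ * ⟪w, w'⟫ := by
  simp only [PiLp.inner_apply, act, tp, RCLike.inner_apply, Matrix.toLpLin_apply,
    Fintype.sum_prod_type, Matrix.mulVec, dotProduct, Matrix.kroneckerMap_apply,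
    Matrix.one_apply, WithLp.equiv_symm_apply, map_mul]
  rw [Finset.sum_mul_sum]
  refine Finset.sum_congr rfl fun a _ => Finset.sum_congr rfl fun b _ => ?_
  simp only [mul_ite, mul_one, mul_zero, ite_mul, zero_mul, Finset.sum_ite_eq,
    Finset.mem_univ, if_true, Finset.sum_mul]
  refine Finset.sum_congr rfl fun c _ => ?_
  ring

theorem ket_val {m : ℕ} (a : Fin m) : ket m a = EuclideanSpace.single a 1 := by
  ext b
  simp [ket, Fin.ext_iff]

theorem inner_ket_toEuclideanLin_ket {m : ℕ} (B : Matrix (Fin m) (Fin m) ℂ) (a b : Fin m) :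
    ⟪ket m a, Matrix.toEuclideanLin B (ket m b)⟫ = B a b := by
  simp [ket_val, Matrix.toLpLin_apply, EuclideanSpace.inner_single_left]

theorem inner_ket_ket {n i j : ℕ} (hi : i < n) (hj : j < n) :
    ⟪ket n i, ket n j⟫ = if i = j then 1 else 0 := by
  have := ket_val (⟨i, hi⟩ : Fin n)
  have := ket_val (⟨j, hj⟩ : Fin n)
  simp_all [EuclideanSpace.inner_single_left]

theorem invSqrt2_ne_zero : invSqrt2 ≠ 0 := by
  simp [invSqrt2]

theorem exists_jf_eq {p a : ℕ} (ha : 1 ≤ a) (hap : a ≤ p - 1) :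
    ∃ i, 1 ≤ i ∧ i ≤ p - 1 ∧ jf p i = a := by
  by_cases h : a = 1
  · exact ⟨p - 1, by omega, le_rfl, by simp [jf, h]⟩
  · refine ⟨a - 1, by omega, by omega, ?_⟩
    rw [jf, if_neg (by omega)]
    omega

theorem first_row_column_vanish (p m n : ℕ) (h3 : 3 ≤ p) (hpm : p ≤ m) (hmn : m ≤ n)
    (B : Matrix (Fin m) (Fin m) ℂ) (hB : B.PosSemidef)
    (h : ∀ k l : ℕ, 1 ≤ k → k ≤ 4 * p - 4 → 1 ≤ l → l ≤ 4 * p - 4 → k ≠ l →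
      ⟪psi m n p k, act (B ⊗ₖ (1 : Matrix (Fin n) (Fin n) ℂ)) (psi m n p l)⟫ = 0) :
    ∀ a : Fin m, 1 ≤ (a : ℕ) → (a : ℕ) ≤ p - 1 →
      B (⟨0, by omega⟩ : Fin m) a = 0 ∧ B a (⟨0, by omega⟩ : Fin m) = 0 := by
  intro a ha hap
  set z : Fin m := ⟨0, by omega⟩ with hz
  obtain ⟨i, hi, hip, hj⟩ := exists_jf_eq ha hap
  set c : Fin m := ⟨i, by omega⟩ with hc
  have hψa : psi m n p a = tp (ket m a) (invSqrt2 • (ket n 0 - ket n a)) := by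
    rw [psi, if_pos hap]
  have hminus : psi m n p (i + (p - 1)) =
      tp (invSqrt2 • (ket m z - ket m c)) (ket n a) := by
    rw [psi, if_neg (by omega), if_pos (by omega), Nat.add_sub_cancel, hj]
  have hplus : psi m n p (i + (3 * p - 3)) =
      tp (invSqrt2 • (ket m z + ket m c)) (ket n a) := by
    rw [psi, if_neg (by omega), if_neg (by omega), if_neg (by omega), Nat.add_sub_cancel, hj]
  have e₁ := h a (i + (p - 1)) ha (by omega) (by omega) (by omega) (by omega)
  have e₂ := h a (i + (3 * p - 3)) ha (by omega) (by omega) (by omega) (by omega)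
  have hw : ⟪invSqrt2 • (ket n 0 - ket n a), ket n a⟫ ≠ 0 := by
    rw [inner_smul_left, inner_sub_left, inner_ket_ket (by omega) (by omega),
      inner_ket_ket (by omega) (by omega), if_neg (by omega), if_pos rfl]
    simp [invSqrt2_ne_zero]
  rw [hψa, hminus, inner_tp_act_kronecker_one, map_smul, map_sub, inner_smul_right,
    inner_sub_right, inner_ket_toEuclideanLin_ket, inner_ket_toEuclideanLin_ket] at e₁
  rw [hψa, hplus, inner_tp_act_kronecker_one, map_smul, map_add, inner_smul_right,
    inner_add_right, inner_ket_toEuclideanLin_ket, inner_ket_toEuclideanLin_ket] at e₂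
  have d₁ := (mul_eq_zero.mp ((mul_eq_zero.mp e₁).resolve_right hw)).resolve_left invSqrt2_ne_zero
  have d₂ := (mul_eq_zero.mp ((mul_eq_zero.mp e₂).resolve_right hw)).resolve_left invSqrt2_ne_zero
  have haz : B a z = 0 := by linear_combination (d₁ + d₂) / 2
  exact ⟨by rw [← hB.isHermitian.apply z a, haz, star_zero], haz⟩
end

section
/- If ⟨ψ_k, (B ⊗ I_n) ψ_l⟩ = 0 for all k, l with 1 ≤ k, l ≤ 4p−4 and k ≠ l, then the diagonal entries satisfy B_{ii} = B_{00} for all 1 ≤ i ≤ p−1. -/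
open scoped ComplexInnerProductSpace Kronecker ComplexOrder

/-- A basis vector on the second factor drops out of the sesquilinear form of `B ⊗ I`. -/
theorem inner_tp_ket_act_tp_ket {m n j : ℕ} (hj : j < n) (B : Matrix (Fin m) (Fin m) ℂ)
    (v w : EuclideanSpace ℂ (Fin m)) :
    ⟪tp v (ket n j), act (B ⊗ₖ (1 : Matrix (Fin n) (Fin n) ℂ)) (tp w (ket n j))⟫ =
      ∑ a, ∑ b, star (v a) * B a b * w b := by
  have hket : ∀ x : Fin n, (if (x : ℕ) = j then (1 : ℂ) else 0) = if x = ⟨j, hj⟩ then 1 else 0 :=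
    fun x => by simp only [Fin.ext_iff]
  simp only [PiLp.inner_apply, act, tp, ket, Matrix.toLpLin_apply, Matrix.mulVec,
    dotProduct, Matrix.kroneckerMap_apply, Matrix.one_apply, Fintype.sum_prod_type,
    WithLp.equiv_symm_apply, RCLike.inner_apply, hket]
  refine Finset.sum_congr rfl fun a _ => ?_
  simp [Finset.mul_sum, mul_comm, mul_left_comm, mul_assoc]

/-- The sesquilinear form of `B` on two combinations of `|0⟩` and `|i⟩`. -/
theorem sum_star_mul_mul_ket {m : ℕ} (B : Matrix (Fin m) (Fin m) ℂ) (z a : Fin m)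
    (v w : EuclideanSpace ℂ (Fin m)) (α β γ δ : ℂ)
    (hv : ∀ x, v x = (if x = z then α else 0) + if x = a then β else 0)
    (hw : ∀ x, w x = (if x = z then γ else 0) + if x = a then δ else 0) :
    ∑ x, ∑ y, star (v x) * B x y * w y =
      star α * B z z * γ + star α * B z a * δ + star β * B a z * γ + star β * B a a * δ := by
  simp only [hv, hw, star_add, add_mul, mul_add, Finset.sum_add_distrib, apply_ite star, star_zero,
    ite_mul, mul_ite, zero_mul, mul_zero, Finset.sum_ite_eq',
    Finset.mem_univ, if_true]
  ring

theorem star_invSqrt2 : star invSqrt2 = invSqrt2 := Complex.conj_ofReal _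

theorem diagonal_entries_equal (p m n : ℕ) (h3 : 3 ≤ p) (hpm : p ≤ m) (hmn : m ≤ n)
    (B : Matrix (Fin m) (Fin m) ℂ) (hB : B.PosSemidef)
    (h : ∀ k l : ℕ, 1 ≤ k → k ≤ 4 * p - 4 → 1 ≤ l → l ≤ 4 * p - 4 → k ≠ l →
      ⟪psi m n p k, act (B ⊗ₖ (1 : Matrix (Fin n) (Fin n) ℂ)) (psi m n p l)⟫ = 0) :
    ∀ a : Fin m, 1 ≤ (a : ℕ) → (a : ℕ) ≤ p - 1 →
      B a a = B (⟨0, by omega⟩ : Fin m) (⟨0, by omega⟩ : Fin m) := by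
  intro a ha1 hap
  set z : Fin m := ⟨0, by omega⟩ with hz
  have hj : jf p a < n := by unfold jf; split_ifs <;> omega
  have hminus : psi m n p (a + (p - 1)) =
      tp (invSqrt2 • (ket m 0 - ket m a)) (ket n (jf p a)) := by
    rw [psi, if_neg (by omega), if_pos (by omega), Nat.add_sub_cancel]
  have hplus : psi m n p (a + (3 * p - 3)) =
      tp (invSqrt2 • (ket m 0 + ket m a)) (ket n (jf p a)) := by
    rw [psi, if_neg (by omega), if_neg (by omega), if_neg (by omega), Nat.add_sub_cancel]
  have h1 := h (a + (p - 1)) (a + (3 * p - 3)) (by omega) (by omega) (by omega) (by omega)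
    (by omega)
  have h2 := h (a + (3 * p - 3)) (a + (p - 1)) (by omega) (by omega) (by omega) (by omega)
    (by omega)
  have hm : ∀ x, (invSqrt2 • (ket m 0 - ket m a)) x =
      (if x = z then invSqrt2 else 0) + if x = a then -invSqrt2 else 0 := fun x => by
    simp only [Fin.ext_iff, hz]
    split_ifs <;> simp_all [ket]
  have hp : ∀ x, (invSqrt2 • (ket m 0 + ket m a)) x =
      (if x = z then invSqrt2 else 0) + if x = a then invSqrt2 else 0 := fun x => by
    simp [ket, hz, Fin.ext_iff]
  rw [hminus, hplus, inner_tp_ket_act_tp_ket hj] at h1 h2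
  rw [sum_star_mul_mul_ket B z a _ _ _ _ _ _ hm hp, star_neg, star_invSqrt2] at h1
  rw [sum_star_mul_mul_ket B z a _ _ _ _ _ _ hp hm, star_invSqrt2] at h2
  have hs := invSqrt2_ne_zero
  refine mul_left_cancel₀ (mul_ne_zero hs hs) ?_
  linear_combination (-1 / 2) * (h1 + h2)
end

section
/- In ℂ^3 ⊗ ℂ^3 the five states ψ_1,…,ψ_5 form an unextendible product basis: if v ∈ ℂ^3 and w ∈ ℂ^3 are such that the product state v ⊗ w is orthogonal to each of ψ_1, ψ_2, ψ_3, ψ_4, ψ_5, then v ⊗ w = 0 (equivalently, v = 0 or w = 0). -/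
open scoped ComplexInnerProductSpace Kronecker ComplexOrder

/-- The five product states `ψ_1, …, ψ_5` of Corollary 3. -/
noncomputable def eta (m n k : ℕ) : EuclideanSpace ℂ (Fin m × Fin n) :=
  if k = 1 then tp (ket m 1) (invSqrt2 • (ket n 0 - ket n 1))
  else if k = 2 then tp (ket m 2) (invSqrt2 • (ket n 0 - ket n 2))
  else if k = 3 then tp (invSqrt2 • (ket m 0 - ket m 1)) (ket n 2)
  else if k = 4 then tp (invSqrt2 • (ket m 0 - ket m 2)) (ket n 1)
  else ((3 : ℂ))⁻¹ • tp (ket m 0 + ket m 1 + ket m 2) (ket n 0 + ket n 1 + ket n 2)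

theorem inner_tp_tp {m n : ℕ} (a v : EuclideanSpace ℂ (Fin m)) (b w : EuclideanSpace ℂ (Fin n)) :
    ⟪tp a b, tp v w⟫ = ⟪a, v⟫ * ⟪b, w⟫ := by
  simp only [PiLp.inner_apply, tp, Fintype.sum_prod_type, Finset.sum_mul_sum]
  refine Finset.sum_congr rfl fun i _ => Finset.sum_congr rfl fun j _ => ?_
  simp only [WithLp.equiv_symm_apply, RCLike.inner_apply, map_mul]
  ring

theorem inner_ket_s15 {m : ℕ} (i : Fin m) (v : EuclideanSpace ℂ (Fin m)) : ⟪ket m i, v⟫ = v i := by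
  simp [PiLp.inner_apply, ket, ← Fin.ext_iff]

/-- The coordinate form of unextendibility, over any field of characteristic zero. -/
theorem left_or_right_eq_zero_of_orthogonality {K : Type*} [Field K] [CharZero K] {v w : Fin 3 → K}
    (h₁ : v 1 * (w 0 - w 1) = 0) (h₂ : v 2 * (w 0 - w 2) = 0)
    (h₃ : (v 0 - v 1) * w 2 = 0) (h₄ : (v 0 - v 2) * w 1 = 0)
    (h₅ : (v 0 + v 1 + v 2) * (w 0 + w 1 + w 2) = 0) :
    (∀ i, v i = 0) ∨ ∀ j, w j = 0 := by
  simp only [Fin.forall_fin_succ, Fin.forall_fin_zero, Fin.isValue]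
  simp only [Fin.succ_zero_eq_one, Fin.succ_one_eq_two, and_true]
  simp only [mul_eq_zero] at h₁ h₂ h₃ h₄ h₅
  grind

theorem five_states_upb_three_three (v w : EuclideanSpace ℂ (Fin 3))
    (h : ∀ k, 1 ≤ k → k ≤ 5 → ⟪eta 3 3 k, tp v w⟫ = 0) :
    tp v w = 0 := by
  have ket0 (u : EuclideanSpace ℂ (Fin 3)) : ⟪ket 3 0, u⟫ = u 0 := inner_ket_s15 0 u
  have ket1 (u : EuclideanSpace ℂ (Fin 3)) : ⟪ket 3 1, u⟫ = u 1 := inner_ket_s15 1 u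
  have ket2 (u : EuclideanSpace ℂ (Fin 3)) : ⟪ket 3 2, u⟫ = u 2 := inner_ket_s15 2 u
  have h₁ : v 1 * (w 0 - w 1) = 0 := by
    simpa [eta, inner_tp_tp, inner_smul_left, inner_sub_left, ket0, ket1, invSqrt2_ne_zero]
      using h 1 (by norm_num) (by norm_num)
  have h₂ : v 2 * (w 0 - w 2) = 0 := by
    simpa [eta, inner_tp_tp, inner_smul_left, inner_sub_left, ket0, ket2, invSqrt2_ne_zero]
      using h 2 (by norm_num) (by norm_num)
  have h₃ : (v 0 - v 1) * w 2 = 0 := by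
    simpa [eta, inner_tp_tp, inner_smul_left, inner_sub_left, ket0, ket1, ket2, invSqrt2_ne_zero]
      using h 3 (by norm_num) (by norm_num)
  have h₄ : (v 0 - v 2) * w 1 = 0 := by
    simpa [eta, inner_tp_tp, inner_smul_left, inner_sub_left, ket0, ket1, ket2, invSqrt2_ne_zero]
      using h 4 (by norm_num) (by norm_num)
  have h₅ : (v 0 + v 1 + v 2) * (w 0 + w 1 + w 2) = 0 := by
    simpa [eta, inner_tp_tp, inner_smul_left, inner_add_left, ket0, ket1, ket2]
      using h 5 (by norm_num) (by norm_num)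
  ext ⟨a, b⟩
  rcases left_or_right_eq_zero_of_orthogonality h₁ h₂ h₃ h₄ h₅ with hv | hw
  · simp [tp, hv]
  · simp [tp, hw]
end
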